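/- Let f ∈ C²(T²) have mean value 0 and f not identically zero. Then there exists a closed geodesic γ on T² with length |γ| ≤ ‖∇f‖_{L²}/‖f‖_{L²} (after possibly exchanging coordinates) such that |(1/|γ|)∫_γ f dH¹| ≥ c · ‖f‖²_{L²}/‖∇f‖_{L²}, for a universal constant c > 0. -/

import Mathlib

open MeasureTheory

/-- A function on `ℝ²` that is `ℤ²`-periodic, i.e. a function on the torus `T²`. -/
def Periodic2 (f : ℝ × ℝ → ℂ) : Prop :=
  ∀ x y : ℝ, f (x + 1, y) = f (x, y) ∧ f (x, y + 1) = f (x, y)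

/-- The Fourier coefficient `f̂(k) = ∫_{[0,1]²} f(x,y) e^{-2πi(k₁x + k₂y)}`. -/
noncomputable def fc (f : ℝ × ℝ → ℂ) (k : ℤ × ℤ) : ℂ :=
  ∫ x in (0:ℝ)..1, ∫ y in (0:ℝ)..1,
    f (x, y) * Complex.exp (-2 * (Real.pi : ℂ) * Complex.I * ((k.1 : ℂ) * x + (k.2 : ℂ) * y))

/-- The average of `f` over the closed geodesic `γ(t) = (a t, b t + c)`, `t ∈ [0,1]`:
`(1/|γ|) ∫_γ f dH¹ = ∫₀¹ f(γ(t)) dt`. -/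
noncomputable def geodAvg (f : ℝ × ℝ → ℂ) (a b : ℤ) (c : ℝ) : ℂ :=
  ∫ t in (0:ℝ)..1, f ((a : ℝ) * t, (b : ℝ) * t + c)

/-- The average of `f` over the general closed geodesic `γ(t) = p + t (a,b)`, `t ∈ [0,1]`. -/
noncomputable def geodAvgP (f : ℝ × ℝ → ℂ) (a b : ℤ) (p : ℝ × ℝ) : ℂ :=
  ∫ t in (0:ℝ)..1, f (p.1 + (a : ℝ) * t, p.2 + (b : ℝ) * t)

/-- The squared `L²(T²)` norm of `f`. -/
noncomputable def L2sq (f : ℝ × ℝ → ℂ) : ℝ :=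
  ∫ x in (0:ℝ)..1, ∫ y in (0:ℝ)..1, ‖f (x, y)‖ ^ 2

/-- The `L¹(T²)` norm of `f`. -/
noncomputable def L1norm (f : ℝ × ℝ → ℂ) : ℝ :=
  ∫ x in (0:ℝ)..1, ∫ y in (0:ℝ)..1, ‖f (x, y)‖

/-- Partial derivative in the first variable. -/
noncomputable def pd1 (f : ℝ × ℝ → ℂ) : ℝ × ℝ → ℂ :=
  fun v => deriv (fun x => f (x, v.2)) v.1

/-- Partial derivative in the second variable. -/
noncomputable def pd2 (f : ℝ × ℝ → ℂ) : ℝ × ℝ → ℂ :=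
  fun v => deriv (fun y => f (v.1, y)) v.2

/-- The mixed partial derivative `∂_α f` for the multi-index `α = (α₁, α₂)`. -/
noncomputable def pdMix (a1 a2 : ℕ) (f : ℝ × ℝ → ℂ) : ℝ × ℝ → ℂ :=
  pd1^[a1] (pd2^[a2] f)

/-- The squared `L²(T²)` norm of `∇f`. -/
noncomputable def gradL2sq (f : ℝ × ℝ → ℂ) : ℝ :=
  ∫ x in (0:ℝ)..1, ∫ y in (0:ℝ)..1, (‖pd1 f (x, y)‖ ^ 2 + ‖pd2 f (x, y)‖ ^ 2)

/-- The `n`-th Fourier coefficient of a `1`-periodic function on `ℝ`. -/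
noncomputable def unitFourierCoeff (h : ℝ → ℂ) (n : ℤ) : ℂ :=
  ∫ y in (0:ℝ)..1, h y * Complex.exp (-2 * (Real.pi : ℂ) * Complex.I * ((n : ℂ) * y))

lemma unitFourierCoeff_eq_fourierCoeffOn (h : ℝ → ℂ) (n : ℤ) :
    unitFourierCoeff h n = fourierCoeffOn zero_lt_one h n := by
  rw [fourierCoeffOn_eq_integral, unitFourierCoeff]
  simp only [sub_zero, div_one, one_smul]
  refine intervalIntegral.integral_congr fun y _ => ?_
  simp only [smul_eq_mul]
  rw [fourier_coe_apply, mul_comm]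
  congr 2
  push_cast
  ring

lemma hasSum_sq_unitFourierCoeff {h : ℝ → ℂ} (hc : Continuous h) :
    HasSum (fun n => ‖unitFourierCoeff h n‖ ^ 2) (∫ x in (0:ℝ)..1, ‖h x‖ ^ 2) := by
  have hm : MemLp h 2 (volume.restrict (Set.Ioc 0 1)) := by
    obtain ⟨C, hC⟩ :=
      (isCompact_Icc (a := (0:ℝ)) (b := 1)).exists_bound_of_continuousOn hc.continuousOn
    refine MemLp.of_bound hc.aestronglyMeasurable C ?_
    filter_upwards [ae_restrict_mem measurableSet_Ioc] with x hx
    exact hC x (Set.Ioc_subset_Icc_self hx)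
  simpa [unitFourierCoeff_eq_fourierCoeffOn] using hasSum_sq_fourierCoeffOn zero_lt_one hm

lemma sum_sq_unitFourierCoeff_le {h : ℝ → ℂ} (hc : Continuous h) (S : Finset ℤ) :
    ∑ n ∈ S, ‖unitFourierCoeff h n‖ ^ 2 ≤ ∫ x in (0:ℝ)..1, ‖h x‖ ^ 2 :=
  sum_le_hasSum S (fun _ _ => by positivity) (hasSum_sq_unitFourierCoeff hc)

lemma norm_unitFourierCoeff_deriv {h h' : ℝ → ℂ} (hd : ∀ x, HasDerivAt h (h' x) x)
    (hc : Continuous h') (hp : h 1 = h 0) {n : ℤ} (hn : n ≠ 0) :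
    ‖unitFourierCoeff h' n‖ = 2 * Real.pi * |(n : ℝ)| * ‖unitFourierCoeff h n‖ := by
  have key := fourierCoeffOn_of_hasDerivAt (f := h) (f' := h') zero_lt_one hn (fun x _ => hd x)
    (hc.intervalIntegrable _ _)
  rw [unitFourierCoeff_eq_fourierCoeffOn, unitFourierCoeff_eq_fourierCoeffOn, key, hp]
  have hpi := Real.pi_ne_zero
  have hn' : |(n : ℝ)| ≠ 0 := by positivity
  simp [abs_of_pos Real.pi_pos]
  field_simp

/-- The energy of the frequencies above `M` is controlled by the energy of the derivative. -/
lemma integral_sq_le_low_add_deriv {h h' : ℝ → ℂ} (hd : ∀ x, HasDerivAt h (h' x) x)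
    (hc : Continuous h') (hp : h 1 = h 0) (M : ℕ) :
    ∫ x in (0:ℝ)..1, ‖h x‖ ^ 2 ≤
      ∑ n ∈ Finset.Icc (-(M : ℤ)) M, ‖unitFourierCoeff h n‖ ^ 2 +
        (∫ x in (0:ℝ)..1, ‖h' x‖ ^ 2) / (4 * Real.pi ^ 2 * ((M : ℝ) + 1) ^ 2) := by
  have hcont : Continuous h := continuous_iff_continuousAt.2 fun x => (hd x).continuousAt
  refine hasSum_le_of_sum_le (hasSum_sq_unitFourierCoeff hcont) fun S => ?_
  rw [← Finset.sum_inter_add_sum_sdiff S (Finset.Icc (-(M : ℤ)) M)]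
  refine add_le_add (Finset.sum_le_sum_of_subset_of_nonneg Finset.inter_subset_right
    fun _ _ _ => by positivity) ?_
  have hpos : 0 < 4 * Real.pi ^ 2 * ((M : ℝ) + 1) ^ 2 := by positivity
  rw [le_div_iff₀ hpos, Finset.sum_mul]
  refine le_trans (Finset.sum_le_sum fun n hn => ?_)
    (sum_sq_unitFourierCoeff_le hc (S \ Finset.Icc (-(M : ℤ)) M))
  simp only [Finset.mem_sdiff, Finset.mem_Icc, not_and_or, not_le] at hn
  have hlarge : (M : ℝ) + 1 ≤ |(n : ℝ)| := by
    have : (M : ℤ) + 1 ≤ |n| := by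
      rcases hn.2 with h1 | h1
      · exact le_abs.2 (Or.inr (by omega))
      · exact le_abs.2 (Or.inl (by omega))
    exact_mod_cast this
  have hn0 : n ≠ 0 := by omega
  rw [norm_unitFourierCoeff_deriv hd hc hp hn0]
  have hsq : ((M : ℝ) + 1) ^ 2 ≤ |(n : ℝ)| ^ 2 := by gcongr
  calc ‖unitFourierCoeff h n‖ ^ 2 * (4 * Real.pi ^ 2 * ((M : ℝ) + 1) ^ 2)
      ≤ ‖unitFourierCoeff h n‖ ^ 2 * (4 * Real.pi ^ 2 * |(n : ℝ)| ^ 2) := by gcongr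
    _ = _ := by ring

lemma hasDerivAt_pd1 {F : ℝ × ℝ → ℂ} (hF : ContDiff ℝ 1 F) (x y : ℝ) :
    HasDerivAt (fun s => F (s, y)) (pd1 F (x, y)) x := by
  have hd : DifferentiableAt ℝ (fun s => F (s, y)) x :=
    ((hF.comp (contDiff_id.prodMk contDiff_const)).differentiable one_ne_zero) x
  exact hd.hasDerivAt

lemma hasDerivAt_pd2 {F : ℝ × ℝ → ℂ} (hF : ContDiff ℝ 1 F) (x y : ℝ) :
    HasDerivAt (fun s => F (x, s)) (pd2 F (x, y)) y := by
  have hd : DifferentiableAt ℝ (fun s => F (x, s)) y :=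
    ((hF.comp (contDiff_const.prodMk contDiff_id)).differentiable one_ne_zero) y
  exact hd.hasDerivAt

lemma continuous_pd1 {F : ℝ × ℝ → ℂ} (hF : ContDiff ℝ 1 F) : Continuous (pd1 F) := by
  have h : pd1 F = fun v => fderiv ℝ F v (1, 0) := by
    funext v
    have h1 : HasDerivAt (fun s : ℝ => (s, v.2)) ((1 : ℝ), (0 : ℝ)) v.1 :=
      (hasDerivAt_id v.1).prodMk (hasDerivAt_const v.1 v.2)
    exact (((hF.differentiable one_ne_zero) v).hasFDerivAt.comp_hasDerivAt v.1 h1).deriv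
  rw [h]
  exact (hF.continuous_fderiv one_ne_zero).clm_apply continuous_const

lemma continuous_pd2 {F : ℝ × ℝ → ℂ} (hF : ContDiff ℝ 1 F) : Continuous (pd2 F) := by
  have h : pd2 F = fun v => fderiv ℝ F v (0, 1) := by
    funext v
    have h1 : HasDerivAt (fun s : ℝ => (v.1, s)) ((0 : ℝ), (1 : ℝ)) v.2 :=
      (hasDerivAt_const v.2 v.1).prodMk (hasDerivAt_id v.2)
    exact (((hF.differentiable one_ne_zero) v).hasFDerivAt.comp_hasDerivAt v.2 h1).deriv
  rw [h]
  exact (hF.continuous_fderiv one_ne_zero).clm_apply continuous_const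

/-- Partial Fourier transforms in the second variable may be differentiated in the first one. -/
lemma hasDerivAt_partial_unitFourierCoeff {F : ℝ × ℝ → ℂ} (hF : ContDiff ℝ 1 F) (n : ℤ) (x : ℝ) :
    HasDerivAt (fun s => unitFourierCoeff (fun y => F (s, y)) n)
      (unitFourierCoeff (fun y => pd1 F (x, y)) n) x := by
  have hFc := hF.continuous
  have hFd := continuous_pd1 hF
  obtain ⟨C, hC⟩ := ((isCompact_Icc (a := x - 1) (b := x + 1)).prod
    (isCompact_Icc (a := (0:ℝ)) (b := 1))).exists_bound_of_continuousOn
    (f := fun v : ℝ × ℝ => pd1 F (v.1, v.2) *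
      Complex.exp (-2 * (Real.pi : ℂ) * Complex.I * ((n : ℂ) * (v.2 : ℝ)))) (by fun_prop)
  refine (intervalIntegral.hasDerivAt_integral_of_dominated_loc_of_deriv_le
    (F := fun s y => F (s, y) * Complex.exp (-2 * (Real.pi : ℂ) * Complex.I * ((n : ℂ) * y)))
    (F' := fun s y => pd1 F (s, y) *
      Complex.exp (-2 * (Real.pi : ℂ) * Complex.I * ((n : ℂ) * y)))
    (bound := fun _ => C) (s := Set.Icc (x - 1) (x + 1))
    (Icc_mem_nhds (by linarith) (by linarith)) ?_ ?_ ?_ ?_ ?_ ?_).2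
  · exact Filter.Eventually.of_forall fun s =>
      (show Continuous _ by fun_prop).aestronglyMeasurable
  · exact (show Continuous _ by fun_prop).intervalIntegrable _ _
  · exact (show Continuous _ by fun_prop).aestronglyMeasurable
  · refine Filter.Eventually.of_forall fun y hy s hs => hC (s, y) ⟨hs, ?_⟩
    rw [Set.uIoc_of_le zero_le_one] at hy
    exact Set.Ioc_subset_Icc_self hy
  · exact intervalIntegrable_const
  · exact Filter.Eventually.of_forall fun y _ s _ => (hasDerivAt_pd1 hF s y).mul_const _

lemma continuous_partial_unitFourierCoeff {F : ℝ × ℝ → ℂ} (hF : Continuous F) (n : ℤ) :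
    Continuous fun x => unitFourierCoeff (fun y => F (x, y)) n := by
  refine intervalIntegral.continuous_parametric_intervalIntegral_of_continuous' ?_ 0 1
  fun_prop

lemma fc_eq_iterated (F : ℝ × ℝ → ℂ) (m n : ℤ) :
    fc F (m, n) = unitFourierCoeff (fun x => unitFourierCoeff (fun y => F (x, y)) n) m := by
  simp only [fc, unitFourierCoeff]
  refine intervalIntegral.integral_congr fun x _ => ?_
  rw [← intervalIntegral.integral_mul_const]
  refine intervalIntegral.integral_congr fun y _ => ?_
  rw [mul_assoc (F (x, y)), ← Complex.exp_add]
  congr 2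
  ring

lemma continuous_intervalIntegral_right {E : Type*} [NormedAddCommGroup E] [NormedSpace ℝ E]
    {G : ℝ × ℝ → E} (hG : Continuous G) : Continuous fun x => ∫ y in (0:ℝ)..1, G (x, y) :=
  intervalIntegral.continuous_parametric_intervalIntegral_of_continuous' (by fun_prop) 0 1

lemma integral_integral_swap_of_continuous {E : Type*} [NormedAddCommGroup E] [NormedSpace ℝ E]
    {G : ℝ → ℝ → E} (hG : Continuous G.uncurry) :
    ∫ x in (0:ℝ)..1, ∫ y in (0:ℝ)..1, G x y = ∫ y in (0:ℝ)..1, ∫ x in (0:ℝ)..1, G x y := by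
  apply intervalIntegral_intervalIntegral_swap
  refine (hG.continuousOn.integrableOn_compact ((isCompact_uIcc (a := (0:ℝ)) (b := 1)).prod
    (isCompact_uIcc (a := (0:ℝ)) (b := 1)))).mono_set ?_
  exact Set.prod_mono Set.uIoc_subset_uIcc Set.uIoc_subset_uIcc

lemma gradL2sq_eq_add {F : ℝ × ℝ → ℂ} (hF : ContDiff ℝ 1 F) :
    gradL2sq F = (∫ x in (0:ℝ)..1, ∫ y in (0:ℝ)..1, ‖pd1 F (x, y)‖ ^ 2) +
      ∫ x in (0:ℝ)..1, ∫ y in (0:ℝ)..1, ‖pd2 F (x, y)‖ ^ 2 := by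
  have h1 := continuous_pd1 hF
  have h2 := continuous_pd2 hF
  rw [gradL2sq, ← intervalIntegral.integral_add]
  · refine intervalIntegral.integral_congr fun x _ => ?_
    exact intervalIntegral.integral_add ((show Continuous _ by fun_prop).intervalIntegrable _ _)
      ((show Continuous _ by fun_prop).intervalIntegrable _ _)
  · exact (continuous_intervalIntegral_right
      (G := fun v => ‖pd1 F v‖ ^ 2) (by fun_prop)).intervalIntegrable _ _
  · exact (continuous_intervalIntegral_right
      (G := fun v => ‖pd2 F v‖ ^ 2) (by fun_prop)).intervalIntegrable _ _

/-- The energy of a function on the torus outside the frequency box `[-M, M]²` is controlled by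
the energy of its gradient. -/
lemma L2sq_le_low_add_grad {F : ℝ × ℝ → ℂ} (hp : Periodic2 F) (hF : ContDiff ℝ 1 F) (M : ℕ) :
    L2sq F ≤ ∑ k ∈ Finset.Icc (-(M : ℤ)) M ×ˢ Finset.Icc (-(M : ℤ)) M, ‖fc F k‖ ^ 2 +
      gradL2sq F / (4 * Real.pi ^ 2 * ((M : ℝ) + 1) ^ 2) := by
  set I := Finset.Icc (-(M : ℤ)) M
  set K := 4 * Real.pi ^ 2 * ((M : ℝ) + 1) ^ 2
  have hK : 0 < K := by positivity
  have hFc := hF.continuous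
  have hc1 := continuous_pd1 hF
  have hc2 := continuous_pd2 hF
  have hH : ∀ n : ℤ, Continuous fun x => unitFourierCoeff (fun y => F (x, y)) n :=
    continuous_partial_unitFourierCoeff hFc
  have hH' : ∀ n : ℤ, Continuous fun x => unitFourierCoeff (fun y => pd1 F (x, y)) n :=
    continuous_partial_unitFourierCoeff hc1
  have hH_sq : ∀ n : ℤ, Continuous fun x => ‖unitFourierCoeff (fun y => F (x, y)) n‖ ^ 2 :=
    fun n => (hH n).norm.pow 2
  have hH'_sq : ∀ n : ℤ, Continuous fun x => ‖unitFourierCoeff (fun y => pd1 F (x, y)) n‖ ^ 2 :=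
    fun n => (hH' n).norm.pow 2
  have hi2 : Continuous fun x => ∫ y in (0:ℝ)..1, ‖pd2 F (x, y)‖ ^ 2 :=
    continuous_intervalIntegral_right (G := fun v => ‖pd2 F v‖ ^ 2) (by fun_prop)
  have hi1 : Continuous fun x => ∫ y in (0:ℝ)..1, ‖pd1 F (x, y)‖ ^ 2 :=
    continuous_intervalIntegral_right (G := fun v => ‖pd1 F v‖ ^ 2) (by fun_prop)
  have hi0 : Continuous fun x => ∫ y in (0:ℝ)..1, ‖F (x, y)‖ ^ 2 :=
    continuous_intervalIntegral_right (G := fun v => ‖F v‖ ^ 2) (by fun_prop)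
  have hvert : L2sq F ≤ ∑ n ∈ I, (∫ x in (0:ℝ)..1, ‖unitFourierCoeff (fun y => F (x, y)) n‖ ^ 2) +
      (∫ x in (0:ℝ)..1, ∫ y in (0:ℝ)..1, ‖pd2 F (x, y)‖ ^ 2) / K := by
    rw [← intervalIntegral.integral_finsetSum
        fun n _ => (hH_sq n).intervalIntegrable _ _,
      ← intervalIntegral.integral_div, ← intervalIntegral.integral_add
        ((show Continuous _ by fun_prop).intervalIntegrable _ _)
        ((show Continuous _ by fun_prop).intervalIntegrable _ _)]
    refine intervalIntegral.integral_mono_on zero_le_one (hi0.intervalIntegrable _ _)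
      ((show Continuous _ by fun_prop).intervalIntegrable _ _) fun x _ => ?_
    refine integral_sq_le_low_add_deriv (fun y => hasDerivAt_pd2 hF x y) (by fun_prop) ?_ M
    simpa using (hp x 0).2
  have hhor : ∀ n : ℤ, ∫ x in (0:ℝ)..1, ‖unitFourierCoeff (fun y => F (x, y)) n‖ ^ 2 ≤
      ∑ m ∈ I, ‖fc F (m, n)‖ ^ 2 +
        (∫ x in (0:ℝ)..1, ‖unitFourierCoeff (fun y => pd1 F (x, y)) n‖ ^ 2) / K := by
    intro n
    simp only [fc_eq_iterated]
    refine integral_sq_le_low_add_deriv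
      (fun x => hasDerivAt_partial_unitFourierCoeff hF n x) (hH' n) ?_ M
    congr 1
    funext y
    simpa using (hp 0 y).1
  have hbessel : ∑ n ∈ I,
      (∫ x in (0:ℝ)..1, ‖unitFourierCoeff (fun y => pd1 F (x, y)) n‖ ^ 2) ≤
        ∫ x in (0:ℝ)..1, ∫ y in (0:ℝ)..1, ‖pd1 F (x, y)‖ ^ 2 := by
    rw [← intervalIntegral.integral_finsetSum
        fun n _ => (hH'_sq n).intervalIntegrable _ _]
    exact intervalIntegral.integral_mono_on zero_le_one
      ((show Continuous _ by fun_prop).intervalIntegrable _ _)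
      (hi1.intervalIntegrable _ _) fun x _ => sum_sq_unitFourierCoeff_le (by fun_prop) I
  have hsum := Finset.sum_le_sum fun n (_ : n ∈ I) => hhor n
  rw [Finset.sum_add_distrib, ← Finset.sum_div] at hsum
  have hdiv := div_le_div_of_nonneg_right hbessel hK.le
  rw [Finset.sum_product_right, gradL2sq_eq_add hF, add_div]
  linarith

lemma Periodic2.add_int {F : ℝ × ℝ → ℂ} (hp : Periodic2 F) (x y : ℝ) (m n : ℤ) :
    F (x + m, y + n) = F (x, y) := by
  have h1 : Function.Periodic (fun s => F (s, y + n)) 1 := fun s => (hp s _).1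
  have h2 : Function.Periodic (fun s => F (x, s)) 1 := fun s => (hp x s).2
  have e1 := h1.int_mul m x
  have e2 := h2.int_mul n y
  simp only [mul_one] at e1 e2
  rw [e1, e2]

lemma Periodic2.integral_translate {G : ℝ × ℝ → ℂ} (hp : Periodic2 G) (s t : ℝ) :
    ∫ x in (0:ℝ)..1, ∫ y in (0:ℝ)..1, G (x + s, y + t) =
      ∫ x in (0:ℝ)..1, ∫ y in (0:ℝ)..1, G (x, y) := by
  have h2 : ∀ x, ∫ y in (0:ℝ)..1, G (x, y + t) = ∫ y in (0:ℝ)..1, G (x, y) := by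
    intro x
    have h : Function.Periodic (fun y => G (x, y)) 1 := fun y => (hp x y).2
    rw [intervalIntegral.integral_comp_add_right (fun y => G (x, y)), zero_add, add_comm 1 t,
      h.intervalIntegral_add_eq t 0, zero_add]
  simp only [h2]
  have h : Function.Periodic (fun x => ∫ y in (0:ℝ)..1, G (x, y)) 1 := by
    intro x
    simp only [fun y => (hp x y).1]
  rw [intervalIntegral.integral_comp_add_right (fun x => ∫ y in (0:ℝ)..1, G (x, y)), zero_add,
    add_comm 1 s, h.intervalIntegral_add_eq s 0, zero_add]

/-- A Fourier coefficient whose frequency is orthogonal to the direction `(a, b)` is bounded by the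
largest average over a closed geodesic in that direction. -/
lemma norm_fc_le_of_geodAvgP_le {F : ℝ × ℝ → ℂ} (hp : Periodic2 F) (hF : Continuous F)
    {k : ℤ × ℤ} {a b : ℤ} (hk : k.1 * a + k.2 * b = 0) {B : ℝ}
    (hB : ∀ p, ‖geodAvgP F a b p‖ ≤ B) : ‖fc F k‖ ≤ B := by
  set e : ℝ × ℝ → ℂ := fun v =>
    Complex.exp (-2 * (Real.pi : ℂ) * Complex.I * ((k.1 : ℂ) * v.1 + (k.2 : ℂ) * v.2)) with he
  have hec : Continuous e := by fun_prop
  have hper : Periodic2 fun v => F v * e v := by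
    intro x y
    refine ⟨?_, ?_⟩
    · simp only [he, (hp x y).1]
      congr 1
      refine Complex.exp_eq_exp_iff_exists_int.2 ⟨-k.1, ?_⟩
      push_cast
      ring
    · simp only [he, (hp x y).2]
      congr 1
      refine Complex.exp_eq_exp_iff_exists_int.2 ⟨-k.2, ?_⟩
      push_cast
      ring
  have hinv : ∀ x y t : ℝ, e (x + a * t, y + b * t) = e (x, y) := by
    intro x y t
    have hk' : (k.1 : ℂ) * a + k.2 * b = 0 := by exact_mod_cast hk
    simp only [he]
    congr 1
    push_cast
    linear_combination (-2 * (Real.pi : ℂ) * Complex.I * t) * hk'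
  have hnorm : ∀ v, ‖e v‖ = 1 := by
    intro v
    have : e v = Complex.exp
        (((-2 * Real.pi * (k.1 * v.1 + k.2 * v.2) : ℝ) : ℂ) * Complex.I) := by
      simp only [he]
      congr 1
      push_cast
      ring
    rw [this, Complex.norm_exp_ofReal_mul_I]
  have hfc : fc F k = ∫ x in (0:ℝ)..1, ∫ y in (0:ℝ)..1, e (x, y) * geodAvgP F a b (x, y) := by
    calc fc F k = ∫ x in (0:ℝ)..1, ∫ y in (0:ℝ)..1, F (x, y) * e (x, y) := rfl
      _ = ∫ t in (0:ℝ)..1, ∫ x in (0:ℝ)..1, ∫ y in (0:ℝ)..1,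
            F (x + a * t, y + b * t) * e (x + a * t, y + b * t) := by
          simp only [fun t : ℝ => hper.integral_translate ((a : ℝ) * t) ((b : ℝ) * t)]
          simp
      _ = ∫ x in (0:ℝ)..1, ∫ t in (0:ℝ)..1, ∫ y in (0:ℝ)..1,
            F (x + a * t, y + b * t) * e (x + a * t, y + b * t) := by
          refine integral_integral_swap_of_continuous ?_
          refine intervalIntegral.continuous_parametric_intervalIntegral_of_continuous' ?_ 0 1
          fun_prop
      _ = _ := by
          refine intervalIntegral.integral_congr fun x _ => ?_
          rw [integral_integral_swap_of_continuous (by fun_prop)]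
          refine intervalIntegral.integral_congr fun y _ => ?_
          simp only [hinv, geodAvgP]
          rw [intervalIntegral.integral_mul_const, mul_comm]
  have hinner : ∀ x : ℝ, ‖∫ y in (0:ℝ)..1, e (x, y) * geodAvgP F a b (x, y)‖ ≤ B := by
    intro x
    refine (intervalIntegral.norm_integral_le_of_norm_le_const (C := B) fun y _ => ?_).trans
      (by simp)
    rw [norm_mul, hnorm, one_mul]
    exact hB _
  rw [hfc]
  exact (intervalIntegral.norm_integral_le_of_norm_le_const fun x _ => hinner x).trans (by simp)

lemma geodAvgP_eq_geodAvg {F : ℝ × ℝ → ℂ} (hp : Periodic2 F) {a : ℤ} (ha : a ≠ 0) (b : ℤ)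
    (p : ℝ × ℝ) :
    geodAvgP F a b p = geodAvg F a b (Int.fract (p.2 - b * (p.1 / a))) := by
  have ha' : (a : ℝ) ≠ 0 := by exact_mod_cast ha
  set c := p.2 - b * (p.1 / a) with hc
  have hφ : Function.Periodic (fun t : ℝ => F (a * t, b * t + c)) 1 := by
    intro t
    simp only
    rw [← hp.add_int (a * t) (b * t + c) a b]
    congr 2 <;> ring
  calc geodAvgP F a b p = ∫ t in (0:ℝ)..1, F (a * (t + p.1 / a), b * (t + p.1 / a) + c) := by
        refine intervalIntegral.integral_congr fun t _ => ?_
        simp only [hc]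
        congr 2
        · field_simp
          ring
        · ring
    _ = ∫ t in (0:ℝ)..1, F (a * t, b * t + c) := by
        rw [intervalIntegral.integral_comp_add_right (fun t : ℝ => F (a * t, b * t + c)), zero_add,
          add_comm 1, hφ.intervalIntegral_add_eq _ 0, zero_add]
    _ = _ := by
        refine intervalIntegral.integral_congr fun t _ => ?_
        have h := hp.add_int (a * t) (b * t + Int.fract c) 0 ⌊c⌋
        rw [← h]
        congr 2
        · simp
        · rw [add_assoc, Int.fract_add_floor]

lemma L2sq_pos {F : ℝ × ℝ → ℂ} (hp : Periodic2 F) (hF : Continuous F) (h : ∃ v, F v ≠ 0) :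
    0 < L2sq F := by
  obtain ⟨v, hv⟩ := h
  have hw : F (Int.fract v.1, Int.fract v.2) ≠ 0 := by
    rwa [← hp.add_int _ _ ⌊v.1⌋ ⌊v.2⌋, Int.fract_add_floor, Int.fract_add_floor]
  have hmem : ∀ x : ℝ, Int.fract x ∈ Set.Icc (0:ℝ) 1 :=
    fun x => ⟨Int.fract_nonneg x, (Int.fract_lt_one x).le⟩
  refine intervalIntegral.integral_pos zero_lt_one (continuous_intervalIntegral_right
    (G := fun v => ‖F v‖ ^ 2) (by fun_prop)).continuousOn
    (fun x _ => intervalIntegral.integral_nonneg zero_le_one fun y _ => by positivity)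
    ⟨Int.fract v.1, hmem _, ?_⟩
  exact intervalIntegral.integral_pos zero_lt_one (by fun_prop) (fun y _ => by positivity)
    ⟨Int.fract v.2, hmem _, by positivity⟩

/-- A mean-zero function has a large Fourier coefficient at a frequency of size at most
`‖∇F‖ / ‖F‖`. -/
lemma exists_large_fc {F : ℝ × ℝ → ℂ} (hp : Periodic2 F) (hF : ContDiff ℝ 1 F)
    (hpos : 0 < L2sq F) (hmean : fc F (0, 0) = 0) :
    0 < Real.sqrt (gradL2sq F) ∧ ∃ k : ℤ × ℤ, k ≠ 0 ∧
      Real.sqrt ((k.1 : ℝ) ^ 2 + (k.2 : ℝ) ^ 2) ≤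
        Real.sqrt (gradL2sq F) / Real.sqrt (L2sq F) ∧
      3 / 4 * (L2sq F / Real.sqrt (gradL2sq F)) ≤ ‖fc F k‖ := by
  have hgrad : 0 ≤ gradL2sq F := intervalIntegral.integral_nonneg zero_le_one fun x _ =>
    intervalIntegral.integral_nonneg zero_le_one fun y _ => by positivity
  have hlow := L2sq_le_low_add_grad hp hF
  generalize L2sq F = L at *
  generalize gradL2sq F = G at *
  set D := Real.sqrt G / Real.sqrt L with hD
  have hD0 : 0 ≤ D := by positivity
  have hD2 : D ^ 2 * L = G := by
    rw [hD, div_pow, Real.sq_sqrt hgrad, Real.sq_sqrt hpos.le]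
    field_simp
  specialize hlow ⌊D / 4⌋₊
  have hM1 : (⌊D / 4⌋₊ : ℝ) ≤ D / 4 := Nat.floor_le (by positivity)
  have hM2 : D / 4 < (⌊D / 4⌋₊ : ℝ) + 1 := Nat.lt_floor_add_one _
  generalize ⌊D / 4⌋₊ = M at *
  have htail : G / (4 * Real.pi ^ 2 * ((M : ℝ) + 1) ^ 2) ≤ L / 2 := by
    rw [div_le_iff₀ (by positivity), ← hD2]
    have hpi : 9 ≤ Real.pi ^ 2 := by nlinarith [Real.pi_gt_three]
    have hDM : D ^ 2 ≤ 16 * ((M : ℝ) + 1) ^ 2 := by nlinarith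
    have : 16 * ((M : ℝ) + 1) ^ 2 ≤ 2 * Real.pi ^ 2 * ((M : ℝ) + 1) ^ 2 :=
      mul_le_mul_of_nonneg_right (by linarith) (by positivity)
    nlinarith
  set S := Finset.Icc (-(M : ℤ)) M ×ˢ Finset.Icc (-(M : ℤ)) M
  have hcard : (S.card : ℝ) = (2 * (M : ℝ) + 1) ^ 2 := by
    have : ((M : ℤ) + 1 - -(M : ℤ)).toNat = 2 * M + 1 := by omega
    simp only [S, Finset.card_product, Int.card_Icc, this]
    push_cast
    ring
  have hS : S.Nonempty := ⟨(0, 0), by simp [S]⟩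
  obtain ⟨k, hkS, hk⟩ : ∃ k ∈ S, L / 2 / (2 * (M : ℝ) + 1) ^ 2 ≤ ‖fc F k‖ ^ 2 := by
    refine Finset.exists_le_of_sum_le hS ?_
    rw [Finset.sum_const, nsmul_eq_mul, hcard, mul_div_cancel₀ _ (by positivity)]
    linarith
  have hk0 : k ≠ 0 := by
    rintro rfl
    have : 0 < L / 2 / (2 * (M : ℝ) + 1) ^ 2 := by positivity
    rw [show (0 : ℤ × ℤ) = (0, 0) from rfl, hmean] at hk
    simp at hk
    linarith
  simp only [S, Finset.mem_product, Finset.mem_Icc] at hkS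
  obtain ⟨⟨h1, h2⟩, h3, h4⟩ := hkS
  have hM : 1 ≤ M := by
    by_contra hM
    refine hk0 (Prod.ext ?_ ?_)
    · simp only [Prod.fst_zero]; omega
    · simp only [Prod.snd_zero]; omega
  have hMr : (1 : ℝ) ≤ M := by exact_mod_cast hM
  have hDpos : 0 < D := by linarith
  have hsG : 0 < Real.sqrt G := by
    rcases (Real.sqrt_nonneg G).eq_or_lt with h | h
    · simp [hD, ← h] at hDpos
    · exact h
  have hGpos : 0 < G := Real.sqrt_pos.1 hsG
  refine ⟨hsG, k, hk0, ?_, ?_⟩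
  · refine Real.sqrt_le_iff.2 ⟨hD0, ?_⟩
    have b1 : (-(M : ℝ)) ≤ k.1 := by exact_mod_cast h1
    have b2 : (k.1 : ℝ) ≤ M := by exact_mod_cast h2
    have b3 : (-(M : ℝ)) ≤ k.2 := by exact_mod_cast h3
    have b4 : (k.2 : ℝ) ≤ M := by exact_mod_cast h4
    have e1 := sq_le_sq' b1 b2
    have e2 := sq_le_sq' b3 b4
    nlinarith
  · refine le_of_sq_le_sq ?_ (norm_nonneg _)
    refine le_trans ?_ hk
    have hM3 : (2 * (M : ℝ) + 1) ^ 2 ≤ 9 / 16 * D ^ 2 := by nlinarith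
    rw [mul_pow, div_pow L, Real.sq_sqrt hgrad, div_div, mul_div_assoc',
      div_le_div_iff₀ hGpos (by positivity)]
    have h5 : L ^ 2 * (2 * (M : ℝ) + 1) ^ 2 ≤ 9 / 16 * (L * G) := by
      rw [← hD2]
      nlinarith [mul_le_mul_of_nonneg_left hM3 (sq_nonneg L)]
    nlinarith [mul_pos hpos hGpos]

lemma L2sq_swap {F : ℝ × ℝ → ℂ} (hF : Continuous F) :
    L2sq (fun v => F (v.2, v.1)) = L2sq F :=
  integral_integral_swap_of_continuous (G := fun x y => ‖F (y, x)‖ ^ 2) (by fun_prop)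

lemma gradL2sq_swap {F : ℝ × ℝ → ℂ} (hF : ContDiff ℝ 1 F) :
    gradL2sq (fun v => F (v.2, v.1)) = gradL2sq F := by
  have h1 := continuous_pd1 hF
  have h2 := continuous_pd2 hF
  have h := integral_integral_swap_of_continuous
    (G := fun x y => ‖pd1 F (y, x)‖ ^ 2 + ‖pd2 F (y, x)‖ ^ 2) (by fun_prop)
  rw [gradL2sq, gradL2sq, ← h]
  simp only [add_comm (‖pd1 F _‖ ^ 2)]
  rfl

/-- A mean-zero function has a large average over some closed geodesic of length at most
`‖∇F‖ / ‖F‖`. -/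
lemma exists_large_geodAvgP {F : ℝ × ℝ → ℂ} (hp : Periodic2 F) (hF : ContDiff ℝ 1 F)
    (hpos : 0 < L2sq F) (hmean : fc F (0, 0) = 0) :
    ∃ a b : ℤ, ∃ p : ℝ × ℝ, Int.gcd a b = 1 ∧
      Real.sqrt ((a : ℝ) ^ 2 + (b : ℝ) ^ 2) ≤
        Real.sqrt (gradL2sq F) / Real.sqrt (L2sq F) ∧
      1 / 2 * L2sq F / Real.sqrt (gradL2sq F) ≤ ‖geodAvgP F a b p‖ := by
  obtain ⟨hG, ⟨m, n⟩, hk0, hlen, hk⟩ := exists_large_fc hp hF hpos hmean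
  have hgcd : 0 < Int.gcd m n := by
    rw [Int.gcd_pos_iff]
    by_contra! h
    exact hk0 (Prod.ext h.1 h.2)
  obtain ⟨q, r, hqr, hm, hn⟩ := Int.exists_gcd_one hgcd
  set d := Int.gcd m n
  refine ⟨-r, q, ?_⟩
  have hex : ∃ p, 1 / 2 * L2sq F / Real.sqrt (gradL2sq F) ≤ ‖geodAvgP F (-r) q p‖ := by
    by_contra! h
    have hle := norm_fc_le_of_geodAvgP_le hp hF.continuous (k := (m, n)) (a := -r) (b := q)
      (by simp only [hm, hn]; ring) fun p => (h p).le
    have : 0 < L2sq F / Real.sqrt (gradL2sq F) := by positivity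
    rw [mul_div_assoc] at hle
    linarith
  obtain ⟨p, hp'⟩ := hex
  refine ⟨p, ?_, le_trans (Real.sqrt_le_sqrt ?_) hlen, hp'⟩
  · rw [Int.neg_gcd, Int.gcd_comm]
    exact hqr
  · have hd : (1 : ℝ) ≤ d := by exact_mod_cast hgcd
    have hm' : (m : ℝ) = q * d := by exact_mod_cast hm
    have hn' : (n : ℝ) = r * d := by exact_mod_cast hn
    simp only [hm', hn']
    push_cast
    nlinarith [mul_nonneg (add_nonneg (sq_nonneg (q : ℝ)) (sq_nonneg (r : ℝ)))
      (by nlinarith : (0 : ℝ) ≤ (d : ℝ) ^ 2 - 1)]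

/-- for real `f ∈ C²(T²)` with mean value zero, not identically zero on the torus,
there is a closed geodesic `γ(t) = (at, bt+c)` (after possibly exchanging the two coordinates)
of length `|γ| = √(a²+b²) ≤ ‖∇f‖_{L²}/‖f‖_{L²}` whose average of `f` is at least
`c₀ ‖f‖²_{L²}/‖∇f‖_{L²}`, for a universal constant `c₀ > 0`. -/
theorem stmt10 :
    ∃ c₀ : ℝ, 0 < c₀ ∧
      ∀ (f : ℝ × ℝ → ℝ), Periodic2 (fun v => (f v : ℂ)) → ContDiff ℝ 2 f →
        (∫ x in (0:ℝ)..1, ∫ y in (0:ℝ)..1, f (x, y)) = 0 →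
        (∃ v, f v ≠ 0) →
        ∃ g : ℝ × ℝ → ℝ,
          (g = f ∨ g = fun v => f (v.2, v.1)) ∧
          ∃ a b : ℤ, ∃ c : ℝ, Int.gcd a b = 1 ∧ c ∈ Set.Ico (0:ℝ) 1 ∧
            Real.sqrt ((a : ℝ) ^ 2 + (b : ℝ) ^ 2) ≤
              Real.sqrt (gradL2sq (fun v => (g v : ℂ))) /
                Real.sqrt (L2sq (fun v => (g v : ℂ))) ∧
            c₀ * L2sq (fun v => (g v : ℂ)) /
                Real.sqrt (gradL2sq (fun v => (g v : ℂ))) ≤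
              ‖geodAvg (fun v => (g v : ℂ)) a b c‖ := by
  refine ⟨1 / 2, by norm_num, fun f hp hf hmean hne => ?_⟩
  have hF : ContDiff ℝ 1 fun v => (f v : ℂ) :=
    (Complex.ofRealCLM.contDiff.comp hf).of_le one_le_two
  have hpos : 0 < L2sq fun v => (f v : ℂ) :=
    L2sq_pos hp hF.continuous (by simpa using hne)
  have hfc : fc (fun v => (f v : ℂ)) (0, 0) = 0 := by
    simp only [fc, Int.cast_zero, zero_mul, add_zero, mul_zero, Complex.exp_zero, mul_one,
      intervalIntegral.integral_ofReal, hmean, Complex.ofReal_zero]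
  obtain ⟨a, b, p, hab, hlen, havg⟩ := exists_large_geodAvgP hp hF hpos hfc
  have hfract : ∀ c : ℝ, Int.fract c ∈ Set.Ico (0:ℝ) 1 :=
    fun c => ⟨Int.fract_nonneg c, Int.fract_lt_one c⟩
  by_cases ha : a = 0
  · have hb : b ≠ 0 := by
      rintro rfl
      simp [ha] at hab
    refine ⟨fun v => f (v.2, v.1), Or.inr rfl, b, a, Int.fract (p.1 - a * (p.2 / b)), ?_,
      hfract _, ?_⟩
    · rwa [Int.gcd_comm]
    rw [L2sq_swap (F := fun v => (f v : ℂ)) hF.continuous,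
      gradL2sq_swap (F := fun v => (f v : ℂ)) hF]
    refine ⟨by rwa [add_comm], ?_⟩
    have hp' : Periodic2 fun v => (f (v.2, v.1) : ℂ) := fun x y => ⟨(hp y x).2, (hp y x).1⟩
    rw [← geodAvgP_eq_geodAvg hp' hb a (p.2, p.1)]
    exact havg
  · refine ⟨f, Or.inl rfl, a, b, Int.fract (p.2 - b * (p.1 / a)), hab, hfract _, hlen, ?_⟩
    rw [← geodAvgP_eq_geodAvg hp ha]
    exact havg
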